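/- arXiv:2405.07139 — 2 statements merged into one kernel-verified Lean document; each statement's English description precedes it below -/
import Mathlib

section
/- Let n ≥ 1, let A₁, A₂ ∈ ℝ^{n×n}, let θ₁, θ₂ : P → ℝ be functions on a parameter set P, and set A(μ) = θ₁(μ)A₁ + θ₂(μ)A₂. Suppose A(μ₀) is invertible, B = A(μ₀)⁻¹, and c₁ := θ₁(μ₀) ≠ 0. If the vectors (θ₁(μ₁), θ₂(μ₁)) and (θ₁(μ₀), θ₂(μ₀)) in ℝ² are linearly independent, then BA(μ₁) = (θ₁(μ₁)/c₁) I + (θ₂(μ₁) − θ₁(μ₁)θ₂(μ₀)/c₁) B A₂ with θ₂(μ₁) − θ₁(μ₁)θ₂(μ₀)/c₁ ≠ 0, and consequently K_m(BA(μ₁), v) = K_m(BA₂, v) for every integer m ≥ 1 and every v ∈ ℝⁿ. -/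
open Matrix

/-- Krylov subspace `K_m(C, v) = span {v, Cv, ..., C^{m-1} v}`. -/
noncomputable def krylov {n : ℕ} (C : Matrix (Fin n) (Fin n) ℝ) (v : Fin n → ℝ) (m : ℕ) :
    Submodule ℝ (Fin n → ℝ) :=
  Submodule.span ℝ {w | ∃ k < m, w = (C ^ k) *ᵥ v}

theorem krylov_mono {n : ℕ} (C : Matrix (Fin n) (Fin n) ℝ) (v : Fin n → ℝ) :
    Monotone (krylov C v) := fun _ _ h =>
  Submodule.span_mono fun _ ⟨k, hk, hw⟩ => ⟨k, hk.trans_le h, hw⟩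

theorem mulVec_mem_krylov_succ {n m : ℕ} {C : Matrix (Fin n) (Fin n) ℝ} {v w : Fin n → ℝ}
    (hw : w ∈ krylov C v m) : C *ᵥ w ∈ krylov C v (m + 1) := by
  suffices h : krylov C v m ≤ (krylov C v (m + 1)).comap C.mulVecLin from h hw
  refine Submodule.span_le.2 ?_
  rintro _ ⟨k, hk, rfl⟩
  refine Submodule.subset_span ⟨k + 1, by omega, ?_⟩
  rw [pow_succ', ← mulVec_mulVec, mulVecLin_apply]

theorem krylov_smul_one_add_smul_le {n : ℕ} (C : Matrix (Fin n) (Fin n) ℝ) (a b : ℝ)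
    (v : Fin n → ℝ) (m : ℕ) :
    krylov (a • (1 : Matrix (Fin n) (Fin n) ℝ) + b • C) v m ≤ krylov C v m := by
  have key (k : ℕ) :
      ((a • (1 : Matrix (Fin n) (Fin n) ℝ) + b • C) ^ k) *ᵥ v ∈ krylov C v (k + 1) := by
    induction k with
    | zero => exact Submodule.subset_span ⟨0, Nat.one_pos, by simp only [pow_zero]⟩
    | succ k ih =>
      rw [pow_succ', ← mulVec_mulVec, add_mulVec, smul_mulVec, smul_mulVec, one_mulVec]
      exact add_mem (Submodule.smul_mem _ _ (krylov_mono C v (Nat.le_succ _) ih))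
        (Submodule.smul_mem _ _ (mulVec_mem_krylov_succ ih))
  refine Submodule.span_le.2 ?_
  rintro _ ⟨k, hk, rfl⟩
  exact krylov_mono C v hk (key k)

/-- Krylov subspaces are invariant under shifting and nonzero scaling of the matrix. -/
theorem krylov_smul_one_add_smul {n : ℕ} (C : Matrix (Fin n) (Fin n) ℝ) (a : ℝ) {b : ℝ}
    (hb : b ≠ 0) (v : Fin n → ℝ) (m : ℕ) :
    krylov (a • (1 : Matrix (Fin n) (Fin n) ℝ) + b • C) v m = krylov C v m := by
  refine le_antisymm (krylov_smul_one_add_smul_le C a b v m) ?_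
  have hC : C = (-(b⁻¹ * a)) • (1 : Matrix (Fin n) (Fin n) ℝ) +
      b⁻¹ • (a • (1 : Matrix (Fin n) (Fin n) ℝ) + b • C) := by
    rw [smul_add, smul_smul, smul_smul, inv_mul_cancel₀ hb, neg_smul, one_smul,
      neg_add_cancel_left]
  calc krylov C v m = krylov ((-(b⁻¹ * a)) • (1 : Matrix (Fin n) (Fin n) ℝ) +
        b⁻¹ • (a • (1 : Matrix (Fin n) (Fin n) ℝ) + b • C)) v m := by rw [← hC]
    _ ≤ _ := krylov_smul_one_add_smul_le _ _ _ v m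

theorem stmt1 {n : ℕ} (hn : 1 ≤ n) {P : Type*}
    (A₁ A₂ : Matrix (Fin n) (Fin n) ℝ) (θ₁ θ₂ : P → ℝ)
    (A : P → Matrix (Fin n) (Fin n) ℝ)
    (hA : ∀ μ, A μ = θ₁ μ • A₁ + θ₂ μ • A₂)
    (μ₀ μ₁ : P) (h0 : IsUnit (A μ₀))
    (B : Matrix (Fin n) (Fin n) ℝ) (hB : B = (A μ₀)⁻¹)
    (hc₁ : θ₁ μ₀ ≠ 0)
    (hind : LinearIndependent ℝ ![(θ₁ μ₁, θ₂ μ₁), (θ₁ μ₀, θ₂ μ₀)]) :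
    B * A μ₁ = (θ₁ μ₁ / θ₁ μ₀) • (1 : Matrix (Fin n) (Fin n) ℝ) +
        (θ₂ μ₁ - θ₁ μ₁ * θ₂ μ₀ / θ₁ μ₀) • (B * A₂) ∧
      θ₂ μ₁ - θ₁ μ₁ * θ₂ μ₀ / θ₁ μ₀ ≠ 0 ∧
      ∀ m : ℕ, 1 ≤ m → ∀ v : Fin n → ℝ,
        krylov (B * A μ₁) v m = krylov (B * A₂) v m := by
  have hBA : B * A μ₀ = 1 := by
    rw [hB]
    exact nonsing_inv_mul _ ((isUnit_iff_isUnit_det _).1 h0)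
  have hA₁ : A μ₁ = (θ₁ μ₁ / θ₁ μ₀) • A μ₀ + (θ₂ μ₁ - θ₁ μ₁ * θ₂ μ₀ / θ₁ μ₀) • A₂ := by
    rw [hA μ₁, hA μ₀, smul_add, smul_smul, smul_smul, div_mul_cancel₀ _ hc₁, add_assoc,
      ← add_smul]
    congr 2
    ring
  have hform : B * A μ₁ = (θ₁ μ₁ / θ₁ μ₀) • (1 : Matrix (Fin n) (Fin n) ℝ) +
      (θ₂ μ₁ - θ₁ μ₁ * θ₂ μ₀ / θ₁ μ₀) • (B * A₂) := by
    rw [hA₁, mul_add, mul_smul_comm, mul_smul_comm, hBA]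
  have hne : θ₂ μ₁ - θ₁ μ₁ * θ₂ μ₀ / θ₁ μ₀ ≠ 0 := by
    intro h
    refine one_ne_zero (LinearIndependent.pair_iff.1 hind 1 (-(θ₁ μ₁ / θ₁ μ₀)) ?_).1
    ext
    · simp [hc₁]
    · simp only [Prod.snd_add, Prod.smul_snd, smul_eq_mul, Prod.snd_zero]
      linear_combination h
  refine ⟨hform, hne, fun m _ v => ?_⟩
  rw [hform]
  exact krylov_smul_one_add_smul _ _ hne v m
end

section
/- Let A₁, A₂ ∈ ℝ^{n×n} be symmetric, let θ₁, θ₂ : P → ℝ, set A(μ) = θ₁(μ)A₁ + θ₂(μ)A₂, and let X ∈ ℝ^{n×n} be symmetric positive definite defining the norm ‖v‖_H = √(vᵀXv) and the dual norm ‖f‖_{H*} = sup over v ≠ 0 of (fᵀv)/‖v‖_H. Assume there exist constants c₁ ≥ c₂ > 0 such that for all μ ∈ P and all v, w ∈ ℝⁿ: vᵀA(μ)w ≤ c₁‖v‖_H‖w‖_H and vᵀA(μ)v ≥ c₂‖v‖_H². Fix μ₀, μ₁ ∈ P with θ₁(μ₀)θ₂(μ₁) − θ₂(μ₀)θ₁(μ₁)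 ≠ 0, let B = A(μ₀)⁻¹, f ∈ ℝⁿ, u_μ = A(μ)⁻¹f, K_m = K_m(BA(μ₁), Bf), and let û_μ ∈ K_m be the Galerkin solution, i.e., (A(μ)û_μ)ᵀv = fᵀv for all v ∈ K_m. Then for every μ ∈ P with θ₁(μ₀)θ₂(μ) − θ₂(μ₀)θ₁(μ) ≠ 0, ‖u_μ − û_μ‖_H ≤ (2/c₂)·((c₁/c₂ − 1)/(c₁/c₂ + 1))^m · ‖f‖_{H*}. -/
open Matrix

/-- The `A`-norm `‖v‖_A = √(vᵀ A v)`. -/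
noncomputable def mnorm {n : ℕ} (A : Matrix (Fin n) (Fin n) ℝ) (v : Fin n → ℝ) : ℝ :=
  Real.sqrt (v ⬝ᵥ A *ᵥ v)

open Polynomial in
/-- The scaled and shifted Chebyshev polynomial on `[k⁻¹, k]`, normalised at the origin. -/
theorem exists_polynomial_eval_zero_eq_one_abs_eval_le {k : ℝ} (hk : 1 ≤ k) {m : ℕ} (hm : 1 ≤ m) :
    ∃ p : ℝ[X], p.natDegree ≤ m ∧ p.eval 0 = 1 ∧
      ∀ x ∈ Set.Icc k⁻¹ k, |p.eval x| ≤ 2 * ((k - 1) / (k + 1)) ^ m := by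
  rcases hk.eq_or_lt with rfl | hk
  · refine ⟨1 - X, (natDegree_sub_le _ _).trans (by simpa using hm), by simp, fun x hx => ?_⟩
    have : x = 1 := by simpa using hx
    have hm' : m ≠ 0 := by omega
    simp [this, hm']
  have hk0 : 0 < k := by linarith
  have hk2 : 0 < k ^ 2 - 1 := by nlinarith
  set ρ : ℝ := (k - 1) / (k + 1) with hρ
  have hρ0 : 0 < ρ := div_pos (by linarith) (by linarith)
  set s : ℝ := (k ^ 2 + 1) / (k ^ 2 - 1) with hs
  set t : ℝ := 2 * k / (k ^ 2 - 1) with ht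
  have hcosh : s = Real.cosh (Real.log ρ) := by
    have h1 : k - 1 ≠ 0 := by linarith
    have h2 : k + 1 ≠ 0 := by linarith
    rw [Real.cosh_log hρ0, hs, hρ]
    field_simp
    ring
  have hT : (ρ ^ m)⁻¹ / 2 ≤ (Chebyshev.T ℝ m).eval s := by
    have hpow : ((m : ℤ) : ℝ) * Real.log ρ = Real.log (ρ ^ m) := by
      rw [Real.log_pow, Int.cast_natCast]
    have hρm : 0 < ρ ^ m := pow_pos hρ0 m
    rw [hcosh, Chebyshev.T_real_cosh, hpow, Real.cosh_log hρm]
    linarith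
  have hTpos : 0 < (Chebyshev.T ℝ m).eval s := lt_of_lt_of_le (by positivity) hT
  refine ⟨C ((Chebyshev.T ℝ m).eval s)⁻¹ * (Chebyshev.T ℝ m).comp (C s - C t * X), ?_, ?_, ?_⟩
  · refine (natDegree_C_mul_le _ _).trans (natDegree_comp_le.trans ?_)
    have h1 : (C s - C t * X : ℝ[X]).natDegree ≤ 1 := by compute_degree
    rw [Chebyshev.natDegree_T]
    simpa using Nat.mul_le_mul_left m h1
  · simp [hTpos.ne']
  · rintro x ⟨hx1, hx2⟩
    have hx1' : 1 ≤ k * x := by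
      rw [inv_le_iff_one_le_mul₀ hk0] at hx1
      linarith
    have harg : |s - t * x| ≤ 1 := by
      have : s - t * x = (k ^ 2 + 1 - 2 * k * x) / (k ^ 2 - 1) := by rw [hs, ht]; ring
      rw [this, abs_le, le_div_iff₀ hk2, div_le_iff₀ hk2]
      constructor <;> nlinarith
    have hb := Chebyshev.abs_eval_T_real_le_one m harg
    have hval : ((Chebyshev.T ℝ m).eval s)⁻¹ ≤ 2 * ρ ^ m := by
      have := inv_anti₀ (by positivity) hT
      rwa [inv_div, div_inv_eq_mul] at this
    simp only [eval_mul, eval_C, eval_comp, eval_sub, eval_X, abs_mul]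
    rw [abs_of_pos (inv_pos.2 hTpos)]
    calc _ ≤ (2 * ρ ^ m) * 1 := by gcongr
      _ = _ := mul_one _

open scoped MatrixOrder in
/-- Simultaneous diagonalisation by congruence. -/
theorem Matrix.PosDef.exists_congr_one_diagonal {n : ℕ} {P Q : Matrix (Fin n) (Fin n) ℝ}
    (hP : P.PosDef) (hQ : Q.IsSymm) :
    ∃ (W : Matrix (Fin n) (Fin n) ℝ) (d : Fin n → ℝ),
      Wᵀ * P * W = 1 ∧ Wᵀ * Q * W = diagonal d := by
  obtain ⟨L, hL, hPL⟩ := CStarAlgebra.isStrictlyPositive_iff_eq_star_mul_self.mp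
    hP.isStrictlyPositive
  have hLdet : IsUnit L.det := (Matrix.isUnit_iff_isUnit_det L).1 hL
  have hPL' : P = Lᵀ * L := by simpa [star_eq_conjTranspose] using hPL
  have hM : (L⁻¹ᵀ * Q * L⁻¹).IsHermitian := by
    rw [IsHermitian, conjTranspose_eq_transpose_of_trivial]
    simp only [transpose_mul, transpose_transpose, hQ.eq, Matrix.mul_assoc]
  set U : Matrix (Fin n) (Fin n) ℝ := hM.eigenvectorUnitary.1
  have hUU : Uᵀ * U = 1 := by
    have := Unitary.coe_star_mul_self hM.eigenvectorUnitary
    simpa [star_eq_conjTranspose] using this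
  refine ⟨L⁻¹ * U, hM.eigenvalues, ?_, ?_⟩
  · have h1 : L * L⁻¹ = 1 := Matrix.mul_nonsing_inv L hLdet
    calc (L⁻¹ * U)ᵀ * P * (L⁻¹ * U) = Uᵀ * (L * L⁻¹)ᵀ * (L * L⁻¹) * U := by
          simp only [hPL', transpose_mul, Matrix.mul_assoc]
      _ = 1 := by simp [h1, hUU]
  · have := hM.conjStarAlgAut_star_eigenvectorUnitary
    rw [Unitary.conjStarAlgAut_star_apply] at this
    calc (L⁻¹ * U)ᵀ * Q * (L⁻¹ * U) = Uᴴ * (L⁻¹ᵀ * Q * L⁻¹) * U := by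
          simp only [conjTranspose_eq_transpose_of_trivial, transpose_mul, Matrix.mul_assoc]
      _ = diagonal hM.eigenvalues := this

open Polynomial in
theorem aeval_mul_eq_mul_diagonal {n : ℕ} {C W : Matrix (Fin n) (Fin n) ℝ} {d : Fin n → ℝ}
    (h : C * W = W * diagonal d) (p : ℝ[X]) :
    aeval C p * W = W * diagonal fun i => p.eval (d i) := by
  induction p using Polynomial.induction_on' with
  | add p q hp hq => simp [Matrix.add_mul, hp, hq, ← Matrix.mul_add]
  | monomial k a =>
    have hk : C ^ k * W = W * diagonal d ^ k := by
      induction k with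
      | zero => simp
      | succ k ih => rw [pow_succ, Matrix.mul_assoc, h, ← Matrix.mul_assoc, ih, pow_succ,
          Matrix.mul_assoc]
    rw [aeval_monomial, Matrix.mul_assoc, hk, diagonal_pow, ← Algebra.smul_def,
      ← Matrix.mul_smul, ← diagonal_smul]
    congr 2
    ext i
    simp

theorem dotProduct_mulVec_of_congr_diagonal {n : ℕ} {Q W : Matrix (Fin n) (Fin n) ℝ}
    {d : Fin n → ℝ} (h : Wᵀ * Q * W = diagonal d) (z : Fin n → ℝ) :
    (W *ᵥ z) ⬝ᵥ Q *ᵥ (W *ᵥ z) = ∑ i, d i * z i ^ 2 := by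
  have : (W *ᵥ z) ⬝ᵥ Q *ᵥ (W *ᵥ z) = z ⬝ᵥ (Wᵀ * Q * W) *ᵥ z := by
    rw [← mulVec_mulVec, ← mulVec_mulVec, dotProduct_mulVec z, vecMul_transpose]
  rw [this, h]
  simp only [dotProduct, mulVec_diagonal]
  exact Finset.sum_congr rfl fun i _ => by ring

open Polynomial in
/-- If the spectrum of `P⁻¹ Q` lies in `[a, b]` and `|p| ≤ M` there, then `p(P⁻¹ Q)` is bounded
by `M` in the energy norm of `Q`. -/
theorem dotProduct_mulVec_aeval_le {n : ℕ} {P Q : Matrix (Fin n) (Fin n) ℝ}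
    (hP : P.PosDef) (hQ : Q.IsSymm) {a b M : ℝ} (ha : 0 ≤ a)
    (hlow : ∀ v, a * (v ⬝ᵥ P *ᵥ v) ≤ v ⬝ᵥ Q *ᵥ v)
    (hupp : ∀ v, v ⬝ᵥ Q *ᵥ v ≤ b * (v ⬝ᵥ P *ᵥ v))
    (p : ℝ[X]) (hp : ∀ x ∈ Set.Icc a b, |p.eval x| ≤ M) (u : Fin n → ℝ) :
    (aeval (P⁻¹ * Q) p *ᵥ u) ⬝ᵥ Q *ᵥ (aeval (P⁻¹ * Q) p *ᵥ u) ≤ M ^ 2 * (u ⬝ᵥ Q *ᵥ u) := by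
  obtain ⟨W, d, hW, hd⟩ := hP.exists_congr_one_diagonal hQ
  have hW1 : W * (Wᵀ * P) = 1 := mul_eq_one_comm.1 hW
  have hPinv : P⁻¹ = W * Wᵀ := Matrix.inv_eq_left_inv (by rw [Matrix.mul_assoc, hW1])
  have hCW : P⁻¹ * Q * W = W * diagonal d := by rw [hPinv, ← hd]; simp only [Matrix.mul_assoc]
  have hd_mem : ∀ i, d i ∈ Set.Icc a b := by
    intro i
    have h1 := dotProduct_mulVec_of_congr_diagonal (hW.trans diagonal_one.symm) (Pi.single i 1)
    have h2 := dotProduct_mulVec_of_congr_diagonal hd (Pi.single i 1)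
    simp only [Pi.single_apply, ite_pow, one_pow, ne_eq, OfNat.ofNat_ne_zero, not_false_eq_true,
      zero_pow, mul_ite, mul_one, mul_zero, Finset.sum_ite_eq', Finset.mem_univ, if_true] at h1 h2
    have h3 := hlow (W *ᵥ Pi.single i 1)
    have h4 := hupp (W *ᵥ Pi.single i 1)
    rw [h1, h2] at h3 h4
    exact ⟨by linarith, by linarith⟩
  obtain ⟨z, rfl⟩ : ∃ z, u = W *ᵥ z := ⟨(Wᵀ * P) *ᵥ u, by rw [mulVec_mulVec, hW1, one_mulVec]⟩
  rw [mulVec_mulVec, aeval_mul_eq_mul_diagonal hCW, ← mulVec_mulVec,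
    dotProduct_mulVec_of_congr_diagonal hd, dotProduct_mulVec_of_congr_diagonal hd,
    Finset.mul_sum]
  refine Finset.sum_le_sum fun i _ => ?_
  have h1 : p.eval (d i) ^ 2 ≤ M ^ 2 := sq_le_sq' (abs_le.1 (hp _ (hd_mem i))).1
    (abs_le.1 (hp _ (hd_mem i))).2
  have h2 : 0 ≤ d i * z i ^ 2 := mul_nonneg (ha.trans (hd_mem i).1) (sq_nonneg _)
  rw [mulVec_diagonal]
  nlinarith

open Polynomial in
theorem aeval_mulVec_mem_krylov {n : ℕ} (C : Matrix (Fin n) (Fin n) ℝ) (v : Fin n → ℝ) {m : ℕ}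
    {r : ℝ[X]} (hr : r.natDegree < m) : aeval C r *ᵥ v ∈ krylov C v m := by
  rw [aeval_eq_sum_range, sum_mulVec]
  refine Submodule.sum_mem _ fun k hk => ?_
  rw [smul_mulVec]
  refine Submodule.smul_mem _ _ (Submodule.subset_span ⟨k, ?_, rfl⟩)
  have := Finset.mem_range.1 hk
  omega

open Polynomial in
theorem sub_aeval_mulVec_mem_krylov {n : ℕ} {C D : Matrix (Fin n) (Fin n) ℝ} {a b : ℝ}
    (hC : C = a • 1 + b • D) (u : Fin n → ℝ) {m : ℕ} (hm : 1 ≤ m) {p : ℝ[X]}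
    (hp : p.natDegree ≤ m) (hp0 : p.eval 0 = 1) :
    u - aeval C p *ᵥ u ∈ krylov D (C *ᵥ u) m := by
  set l : ℝ[X] := Polynomial.C a + Polynomial.C b * X with hl
  have hCl : C = aeval D l := by
    simp [hl, hC, Algebra.algebraMap_eq_smul_one]
  have hpC : aeval C p = aeval C p.divX * C + 1 := by
    conv_lhs => rw [← divX_mul_X_add p]
    simp [coeff_zero_eq_eval_zero, hp0]
  have hdeg : (p.divX.comp l).natDegree < m := by
    have h1 : l.natDegree ≤ 1 := by rw [hl]; compute_degree
    have h2 := natDegree_comp_le (p := p.divX) (q := l)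
    have h3 := natDegree_divX_eq_natDegree_tsub_one (p := p)
    have h4 := Nat.mul_le_mul_left p.divX.natDegree h1
    omega
  have heq : u - aeval C p *ᵥ u = -(aeval D (p.divX.comp l) *ᵥ (C *ᵥ u)) := by
    rw [aeval_comp, ← hCl, hpC, add_mulVec, one_mulVec, mulVec_mulVec]
    abel
  rw [heq]
  exact Submodule.neg_mem _ (aeval_mulVec_mem_krylov D _ hdeg)

theorem dotProduct_mulVec_comm_of_isSymm {n : ℕ} {Q : Matrix (Fin n) (Fin n) ℝ} (hQ : Q.IsSymm)
    (v w : Fin n → ℝ) : v ⬝ᵥ Q *ᵥ w = w ⬝ᵥ Q *ᵥ v := by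
  rw [dotProduct_mulVec, dotProduct_comm, ← mulVec_transpose, hQ.eq]

/-- Galerkin solutions are quasi-optimal in the energy norm. -/
theorem galerkin_energy_le {n : ℕ} {Q : Matrix (Fin n) (Fin n) ℝ} (hQ : Q.IsSymm)
    (hpos : ∀ v, 0 ≤ v ⬝ᵥ Q *ᵥ v) (K : Submodule ℝ (Fin n → ℝ)) {u w y : Fin n → ℝ}
    (hw : w ∈ K) (hy : y ∈ K) (hgal : ∀ v ∈ K, (Q *ᵥ w) ⬝ᵥ v = (Q *ᵥ u) ⬝ᵥ v) :
    (u - w) ⬝ᵥ Q *ᵥ (u - w) ≤ (u - y) ⬝ᵥ Q *ᵥ (u - y) := by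
  have horth : (w - y) ⬝ᵥ Q *ᵥ (u - w) = 0 := by
    rw [mulVec_sub, dotProduct_comm, sub_dotProduct, hgal _ (K.sub_mem hw hy), sub_self]
  have horth' := (dotProduct_mulVec_comm_of_isSymm hQ (u - w) (w - y)).trans horth
  have hsplit : u - y = (u - w) + (w - y) := by abel
  rw [hsplit, mulVec_add, add_dotProduct, dotProduct_add, dotProduct_add, horth, horth']
  linarith [hpos (w - y)]

theorem mnorm_sq {n : ℕ} {X : Matrix (Fin n) (Fin n) ℝ} (hX : X.PosDef) (v : Fin n → ℝ) :
    mnorm X v ^ 2 = v ⬝ᵥ X *ᵥ v :=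
  Real.sq_sqrt (by simpa using hX.posSemidef.dotProduct_mulVec_nonneg v)

theorem mnorm_pos {n : ℕ} {X : Matrix (Fin n) (Fin n) ℝ} (hX : X.PosDef) {v : Fin n → ℝ}
    (hv : v ≠ 0) : 0 < mnorm X v :=
  Real.sqrt_pos.2 (by simpa using hX.dotProduct_mulVec_pos hv)

theorem stmt4 {n : ℕ} {P : Type*}
    (A₁ A₂ : Matrix (Fin n) (Fin n) ℝ) (hA₁ : A₁.IsSymm) (hA₂ : A₂.IsSymm)
    (θ₁ θ₂ : P → ℝ) (A : P → Matrix (Fin n) (Fin n) ℝ)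
    (hA : ∀ μ', A μ' = θ₁ μ' • A₁ + θ₂ μ' • A₂)
    (X : Matrix (Fin n) (Fin n) ℝ) (hX : X.PosDef)
    (c₁ c₂ : ℝ) (hc : c₂ ≤ c₁) (hc₂ : 0 < c₂)
    -- boundedness: `vᵀ A(μ) w ≤ c₁ ‖v‖_H ‖w‖_H`
    (hbdd : ∀ (μ' : P) (v w : Fin n → ℝ), v ⬝ᵥ (A μ') *ᵥ w ≤ c₁ * mnorm X v * mnorm X w)
    -- coercivity: `vᵀ A(μ) v ≥ c₂ ‖v‖_H²`
    (hcoer : ∀ (μ' : P) (v : Fin n → ℝ), c₂ * mnorm X v ^ 2 ≤ v ⬝ᵥ (A μ') *ᵥ v)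
    (μ₀ μ₁ μ : P)
    (hdet1 : θ₁ μ₀ * θ₂ μ₁ - θ₂ μ₀ * θ₁ μ₁ ≠ 0)
    (hdet2 : θ₁ μ₀ * θ₂ μ - θ₂ μ₀ * θ₁ μ ≠ 0)
    (B : Matrix (Fin n) (Fin n) ℝ) (hB : B = (A μ₀)⁻¹)
    (f u : Fin n → ℝ) (hu : u = (A μ)⁻¹ *ᵥ f)
    (m : ℕ) (hm : 1 ≤ m)
    (uhat : Fin n → ℝ)
    -- `uhat` is the Galerkin solution in `K_m = K_m(B A(μ₁), B f)`
    (huhat : uhat ∈ krylov (B * A μ₁) (B *ᵥ f) m)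
    (hgal : ∀ v ∈ krylov (B * A μ₁) (B *ᵥ f) m, ((A μ) *ᵥ uhat) ⬝ᵥ v = f ⬝ᵥ v) :
    mnorm X (u - uhat) ≤
      (2 / c₂) * ((c₁ / c₂ - 1) / (c₁ / c₂ + 1)) ^ m *
        sSup {r : ℝ | ∃ v : Fin n → ℝ, v ≠ 0 ∧ r = (f ⬝ᵥ v) / mnorm X v} := by
  have hsymm : ∀ ν, (A ν).IsSymm := fun ν => by
    rw [hA]
    exact (hA₁.smul _).add (hA₂.smul _)
  have hpd : ∀ ν, (A ν).PosDef := fun ν => by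
    refine PosDef.of_dotProduct_mulVec_pos ?_ fun v hv => ?_
    · rw [IsHermitian, conjTranspose_eq_transpose_of_trivial]
      exact hsymm ν
    · have := mnorm_pos hX hv
      have := hcoer ν v
      rw [star_trivial]
      exact lt_of_lt_of_le (by positivity) this
  have hc₁ : 0 < c₁ := by linarith
  have hupp : ∀ ν v, v ⬝ᵥ A ν *ᵥ v ≤ c₁ * mnorm X v ^ 2 := fun ν v => by
    linarith [hbdd ν v v, sq (mnorm X v), mul_assoc c₁ (mnorm X v) (mnorm X v)]
  have hQu : A μ *ᵥ u = f := by
    rw [hu, mulVec_mulVec, Matrix.mul_nonsing_inv _ ((hpd μ).isUnit.map Matrix.detMonoidHom),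
      one_mulVec]
  obtain ⟨p, hpdeg, hp0, hpb⟩ := exists_polynomial_eval_zero_eq_one_abs_eval_le
    ((one_le_div hc₂).2 hc) hm
  set ρ : ℝ := (c₁ / c₂ - 1) / (c₁ / c₂ + 1)
  have hρ0 : 0 ≤ ρ := div_nonneg (by linarith [(one_le_div hc₂).2 hc]) (by positivity)
  -- the pencil through `A μ₀` and `A μ₁` contains `A μ`
  have hC : B * A μ =
      ((θ₁ μ * θ₂ μ₁ - θ₂ μ * θ₁ μ₁) / (θ₁ μ₀ * θ₂ μ₁ - θ₂ μ₀ * θ₁ μ₁)) • 1 +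
      ((θ₁ μ₀ * θ₂ μ - θ₂ μ₀ * θ₁ μ) / (θ₁ μ₀ * θ₂ μ₁ - θ₂ μ₀ * θ₁ μ₁)) • (B * A μ₁) := by
    have hB1 : B * A μ₀ = 1 := by
      rw [hB, Matrix.nonsing_inv_mul _ ((hpd μ₀).isUnit.map Matrix.detMonoidHom)]
    rw [← hB1, ← Matrix.mul_smul, ← Matrix.mul_smul, ← Matrix.mul_add]
    congr 1
    ext i j
    simp only [hA, Matrix.add_apply, Matrix.smul_apply, smul_eq_mul]
    set D := θ₁ μ₀ * θ₂ μ₁ - θ₂ μ₀ * θ₁ μ₁ with hD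
    field_simp
    rw [hD]
    ring
  have hmem := sub_aeval_mulVec_mem_krylov hC u hm hpdeg hp0
  rw [← mulVec_mulVec, hQu] at hmem
  have hopt := galerkin_energy_le (hsymm μ) (fun v => (by positivity : 0 ≤ c₂ * mnorm X v ^ 2).trans
    (hcoer μ v)) _ huhat hmem (u := u) (by rwa [hQu])
  rw [sub_sub_cancel, hB] at hopt
  have hpoly := dotProduct_mulVec_aeval_le (hpd μ₀) (hsymm μ) (a := (c₁ / c₂)⁻¹) (b := c₁ / c₂)
    (by positivity)
    (fun v => by
      rw [inv_div, div_mul_eq_mul_div, div_le_iff₀ hc₁]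
      nlinarith [hcoer μ v, hupp μ₀ v])
    (fun v => by
      rw [div_mul_eq_mul_div, le_div_iff₀ hc₂]
      nlinarith [hcoer μ₀ v, hupp μ v]) p hpb u
  set S := {r : ℝ | ∃ v : Fin n → ℝ, v ≠ 0 ∧ r = (f ⬝ᵥ v) / mnorm X v}
  have hSbdd : BddAbove S := by
    refine ⟨c₁ * mnorm X u, ?_⟩
    rintro r ⟨v, hv, rfl⟩
    rw [div_le_iff₀ (mnorm_pos hX hv), dotProduct_comm, ← hQu]
    linarith [hbdd μ v u]
  have hdual : c₂ * mnorm X u ≤ sSup S ∧ f ⬝ᵥ u ≤ sSup S * mnorm X u := by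
    by_cases hu0 : u = 0
    · have hf0 : f = 0 := by rw [← hQu, hu0, mulVec_zero]
      have : 0 ≤ sSup S := Real.sSup_nonneg (by rintro r ⟨v, -, rfl⟩; simp [hf0])
      simpa [hu0, mnorm] using this
    · have hpos := mnorm_pos hX hu0
      have h1 : f ⬝ᵥ u ≤ sSup S * mnorm X u :=
        (div_le_iff₀ hpos).1 (le_csSup hSbdd ⟨u, hu0, rfl⟩)
      refine ⟨le_of_mul_le_mul_right ?_ hpos, h1⟩
      have h2 := hcoer μ u
      rw [hQu, dotProduct_comm] at h2
      linarith [sq (mnorm X u), mul_assoc c₂ (mnorm X u) (mnorm X u)]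
  have hu_nonneg : 0 ≤ mnorm X u := Real.sqrt_nonneg _
  have hF : 0 ≤ sSup S := (mul_nonneg hc₂.le hu_nonneg).trans hdual.1
  have henergy : c₂ * (f ⬝ᵥ u) ≤ sSup S ^ 2 := by nlinarith [hdual.1, hdual.2]
  have hfinal : (c₂ * mnorm X (u - uhat)) ^ 2 ≤ (2 * ρ ^ m * sSup S) ^ 2 := by
    have h1 := (hcoer μ (u - uhat)).trans (hopt.trans hpoly)
    rw [hQu, dotProduct_comm] at h1
    calc (c₂ * mnorm X (u - uhat)) ^ 2 = c₂ * (c₂ * mnorm X (u - uhat) ^ 2) := by ring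
      _ ≤ c₂ * ((2 * ρ ^ m) ^ 2 * (f ⬝ᵥ u)) := by gcongr
      _ = (2 * ρ ^ m) ^ 2 * (c₂ * (f ⬝ᵥ u)) := by ring
      _ ≤ (2 * ρ ^ m) ^ 2 * sSup S ^ 2 := by gcongr
      _ = _ := by ring
  have hle := le_of_sq_le_sq hfinal (by positivity)
  calc mnorm X (u - uhat) ≤ (2 * ρ ^ m * sSup S) / c₂ := by
        rw [le_div_iff₀ hc₂]
        linarith
    _ = 2 / c₂ * ρ ^ m * sSup S := by ring
end
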